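/- arXiv:2004.08905 — 2 statements merged into one kernel-verified Lean document; each statement's English description precedes it below -/
import Mathlib

section
/- (Non-degeneracy I, item 2.) The map κ ↦ (Ω⃗(κ), √κ) from [κ₁, κ₂] to ℝ^{ν+1} is non-degenerate: for every (c, d) ∈ ℝ^ν × ℝ with (c, d) ≠ 0 there exists κ ∈ [κ₁, κ₂] such that Σ_{a=1}^{ν} c_a · Ω_{j̄_a}(κ) + d·√κ ≠ 0. -/
open Real Finset Set

/-- `G_j := j · tanh(dpt · j)` (finite depth `dpt`). -/
noncomputable def Gfun (dpt : ℝ) (j : ℤ) : ℝ := (j : ℝ) * Real.tanh (dpt * (j : ℝ))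

/-- The linear frequencies `ω_j(κ)`. -/
noncomputable def omegaF (dpt g γ : ℝ) (j : ℤ) (κ : ℝ) : ℝ :=
  Real.sqrt (κ * Gfun dpt j * (j : ℝ) ^ 2 + g * Gfun dpt j + (γ * Gfun dpt j / (2 * (j : ℝ))) ^ 2)

/-- The linear frequencies `Ω_j(κ) = ω_j(κ) + (γ/2) G_j / j`. -/
noncomputable def OmegaF (dpt g γ : ℝ) (j : ℤ) (κ : ℝ) : ℝ :=
  omegaF dpt g γ j κ + γ / 2 * Gfun dpt j / (j : ℝ)

/-- Differentiating a vanishing combination of a constant and shifted powers with a nonzero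
exponent lowers the exponent by one. -/
theorem sum_mul_rpow_sub_one_eq_zero {ι : Type*} [Fintype ι] {b w : ι → ℝ} {s : Set ℝ}
    (hs : IsOpen s) (hpos : ∀ x ∈ s, ∀ i, 0 < x + b i) {r C : ℝ} (hr : r ≠ 0)
    (h : ∀ x ∈ s, ∑ i, w i * (x + b i) ^ r + C = 0) :
    ∀ x ∈ s, ∑ i, w i * (x + b i) ^ (r - 1) = 0 := by
  intro x hx
  have hderiv : HasDerivAt (fun y : ℝ => ∑ i, w i * (y + b i) ^ r + C)
      (∑ i, w i * (1 * r * (x + b i) ^ (r - 1))) x := by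
    refine HasDerivAt.add_const C (HasDerivAt.fun_sum fun i _ => HasDerivAt.const_mul (w i) ?_)
    exact ((hasDerivAt_id' x).add_const (b i)).rpow_const (Or.inl (hpos x hx i).ne')
  have hzero : HasDerivAt (fun y : ℝ => ∑ i, w i * (y + b i) ^ r + C) 0 x :=
    (hasDerivAt_const x (0 : ℝ)).congr_of_eventuallyEq
      (Filter.eventually_of_mem (hs.mem_nhds hx) h)
  have heq := hderiv.unique hzero
  have hfactor : ∑ i, w i * (1 * r * (x + b i) ^ (r - 1)) =
      r * ∑ i, w i * (x + b i) ^ (r - 1) := by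
    rw [Finset.mul_sum]
    exact Finset.sum_congr rfl fun i _ => by ring
  rw [hfactor] at heq
  exact (mul_eq_zero.mp heq).resolve_left hr

/-- The constant function and the functions `x ↦ √(x + b i)` with distinct shifts `b i` are
linearly independent on every nonempty open set where all `x + b i` are positive. -/
theorem eq_zero_of_sum_mul_sqrt_add_eq_zero {n : ℕ} {b w : Fin n → ℝ} {s : Set ℝ}
    (hb : Function.Injective b) (hs : IsOpen s) (hne : s.Nonempty)
    (hpos : ∀ x ∈ s, ∀ i, 0 < x + b i) {C : ℝ}
    (h : ∀ x ∈ s, ∑ i, w i * √(x + b i) + C = 0) : w = 0 := by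
  have hpow : ∀ k : ℕ, ∀ x ∈ s, ∑ i, w i * (x + b i) ^ (-(1 / 2) - k : ℝ) = 0 := by
    intro k
    induction k with
    | zero =>
      intro x hx
      have := sum_mul_rpow_sub_one_eq_zero (C := C) (w := w) hs hpos (r := 1 / 2) (by norm_num)
        (by simpa only [Real.sqrt_eq_rpow] using h) x hx
      norm_num at this ⊢
      exact this
    | succ k ih =>
      intro x hx
      have hr : (-(1 / 2) - k : ℝ) ≠ 0 := by
        have : (0 : ℝ) ≤ k := k.cast_nonneg
        linarith
      have := sum_mul_rpow_sub_one_eq_zero (C := 0) (w := w) hs hpos hr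
        (by simpa only [add_zero] using ih) x hx
      rw [sub_sub] at this
      exact_mod_cast this
  obtain ⟨x, hx⟩ := hne
  have hinj : Function.Injective fun i => (x + b i)⁻¹ := fun i j hij =>
    hb (add_left_cancel (inv_injective hij))
  have hv := Matrix.eq_zero_of_forall_pow_sum_mul_pow_eq_zero
    (v := fun i => w i * (x + b i) ^ (-(1 / 2) : ℝ)) hinj fun k => by
      rw [← hpow k x hx]
      refine Finset.sum_congr rfl fun i _ => ?_
      rw [Real.rpow_sub_natCast (hpos x hx i).ne', inv_pow, mul_assoc, ← div_eq_mul_inv]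
  funext i
  exact (mul_eq_zero.mp (congrFun hv i)).resolve_right (Real.rpow_pos_of_pos (hpos x hx i) _).ne'

theorem Real.sinh_le_self_mul_cosh {x : ℝ} (hx : 0 ≤ x) : Real.sinh x ≤ x * Real.cosh x := by
  have hmono : MonotoneOn (fun t => t * Real.cosh t - Real.sinh t) (Set.Ici 0) := by
    refine monotoneOn_of_deriv_nonneg (convex_Ici 0) (by fun_prop) (by fun_prop) fun t ht => ?_
    rw [interior_Ici] at ht
    have hd : HasDerivAt (fun t => t * Real.cosh t - Real.sinh t)
        (1 * Real.cosh t + t * Real.sinh t - Real.cosh t) t :=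
      ((hasDerivAt_id' t).mul (Real.hasDerivAt_cosh t)).sub (Real.hasDerivAt_sinh t)
    rw [hd.deriv]
    have : 0 ≤ t * Real.sinh t := mul_nonneg ht.le (Real.sinh_nonneg_iff.mpr ht.le)
    linarith
  have := hmono Set.self_mem_Ici hx hx
  simp only [Real.sinh_zero, zero_mul, sub_zero] at this
  linarith

/-- The function `x ↦ tanh x / x` is antitone on the positive half-line. -/
theorem Real.mul_tanh_le_mul_tanh {x y : ℝ} (hx : 0 ≤ x) (hxy : x ≤ y) :
    x * Real.tanh y ≤ y * Real.tanh x := by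
  have hcx := Real.cosh_pos x
  have hcy := Real.cosh_pos y
  have hsub : 0 ≤ y - x := sub_nonneg.mpr hxy
  have hsinh : Real.sinh (y - x) ≤ (y - x) * Real.cosh y := by
    refine (Real.sinh_le_self_mul_cosh hsub).trans (mul_le_mul_of_nonneg_left ?_ hsub)
    rw [Real.cosh_le_cosh, abs_of_nonneg hsub, abs_of_nonneg (hx.trans hxy)]
    linarith
  have hle : x * Real.sinh (y - x) ≤ Real.sinh x * ((y - x) * Real.cosh y) :=
    mul_le_mul (Real.self_le_sinh_iff.mpr hx) hsinh (Real.sinh_nonneg_iff.mpr hsub)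
      (Real.sinh_nonneg_iff.mpr hx)
  rw [Real.sinh_sub] at hle
  rw [Real.tanh_eq_sinh_div_cosh, Real.tanh_eq_sinh_div_cosh, ← mul_div_assoc, ← mul_div_assoc,
    div_le_div_iff₀ hcy hcx]
  linarith

theorem Real.tanh_pos_of_pos {x : ℝ} (hx : 0 < x) : 0 < Real.tanh x := by
  rw [Real.tanh_eq_sinh_div_cosh]
  exact div_pos (Real.sinh_pos_iff.mpr hx) (Real.cosh_pos x)

theorem Gfun_abs (dpt : ℝ) (j : ℤ) : Gfun dpt |j| = Gfun dpt j := by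
  rcases abs_choice j with h | h <;> rw [h]
  simp [Gfun, Real.tanh_neg]

theorem Gfun_pos {dpt : ℝ} (hdpt : 0 < dpt) {j : ℤ} (hj : j ≠ 0) : 0 < Gfun dpt j := by
  rw [← Gfun_abs]
  have : (0 : ℝ) < (|j| : ℤ) := by exact_mod_cast abs_pos.mpr hj
  exact mul_pos this (Real.tanh_pos_of_pos (mul_pos hdpt this))

/-- The number `b` such that `ω_j(κ)` is a multiple of `√(κ + b)`. -/
noncomputable def omegaShift (dpt g γ : ℝ) (j : ℤ) : ℝ :=
  g / (j : ℝ) ^ 2 + γ ^ 2 * Gfun dpt j / (4 * (j : ℝ) ^ 4)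

theorem omegaShift_abs (dpt g γ : ℝ) (j : ℤ) :
    omegaShift dpt g γ |j| = omegaShift dpt g γ j := by
  simp only [omegaShift, Gfun_abs]
  rcases abs_choice j with h | h <;> rw [h]
  push_cast
  rw [even_two.neg_pow, Even.neg_pow (by decide : Even 4)]

theorem omegaShift_pos {dpt g : ℝ} (hdpt : 0 < dpt) (hg : 0 < g) (γ : ℝ) {j : ℤ} (hj : j ≠ 0) :
    0 < omegaShift dpt g γ j := by
  have hG := Gfun_pos hdpt hj
  have hj' : (j : ℝ) ≠ 0 := by exact_mod_cast hj
  unfold omegaShift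
  positivity

theorem omegaShift_lt {dpt g : ℝ} (hdpt : 0 < dpt) (hg : 0 < g) (γ : ℝ) {m n : ℤ} (hm : 0 < m)
    (hmn : m < n) : omegaShift dpt g γ n < omegaShift dpt g γ m := by
  have hm' : (0 : ℝ) < m := by exact_mod_cast hm
  have hmn' : (m : ℝ) < n := by exact_mod_cast hmn
  have hn' : (0 : ℝ) < n := hm'.trans hmn'
  have hGn := Gfun_pos hdpt (hm.trans hmn).ne'
  have htanh : (m : ℝ) * Real.tanh (dpt * n) ≤ n * Real.tanh (dpt * m) := by
    have := Real.mul_tanh_le_mul_tanh (mul_pos hdpt hm').le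
      (mul_le_mul_of_nonneg_left hmn'.le hdpt.le)
    rw [mul_assoc, mul_assoc] at this
    exact le_of_mul_le_mul_left this hdpt
  have hG : (m : ℝ) ^ 2 * Gfun dpt n ≤ n ^ 2 * Gfun dpt m := by
    have := mul_le_mul_of_nonneg_left htanh (mul_pos hm' hn').le
    simp only [Gfun]
    linarith
  have hsq : (m : ℝ) ^ 2 < n ^ 2 := by gcongr
  have hG' : (m : ℝ) ^ 4 * Gfun dpt n ≤ n ^ 4 * Gfun dpt m := calc
    (m : ℝ) ^ 4 * Gfun dpt n = m ^ 2 * (m ^ 2 * Gfun dpt n) := by ring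
    _ ≤ n ^ 2 * (n ^ 2 * Gfun dpt m) :=
      mul_le_mul hsq.le hG (by positivity) (by positivity)
    _ = n ^ 4 * Gfun dpt m := by ring
  refine add_lt_add_of_lt_of_le (div_lt_div_of_pos_left hg (by positivity) hsq) ?_
  rw [div_le_div_iff₀ (by positivity) (by positivity)]
  have := mul_le_mul_of_nonneg_left hG' (by positivity : 0 ≤ 4 * γ ^ 2)
  linarith

theorem abs_eq_abs_of_omegaShift_eq {dpt g : ℝ} (hdpt : 0 < dpt) (hg : 0 < g) {γ : ℝ} {i j : ℤ}
    (hi : i ≠ 0) (hj : j ≠ 0) (h : omegaShift dpt g γ i = omegaShift dpt g γ j) :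
    |i| = |j| := by
  rw [← omegaShift_abs dpt g γ i, ← omegaShift_abs dpt g γ j] at h
  rcases lt_trichotomy |i| |j| with hlt | heq | hlt
  · exact absurd h (omegaShift_lt hdpt hg γ (abs_pos.mpr hi) hlt).ne'
  · exact heq
  · exact absurd h (omegaShift_lt hdpt hg γ (abs_pos.mpr hj) hlt).ne

theorem omegaF_eq_sqrt_mul_sqrt {dpt : ℝ} (hdpt : 0 < dpt) (g γ : ℝ) {j : ℤ} (hj : j ≠ 0)
    (κ : ℝ) :
    omegaF dpt g γ j κ = √(Gfun dpt j * (j : ℝ) ^ 2) * √(κ + omegaShift dpt g γ j) := by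
  have hG := Gfun_pos hdpt hj
  have hj' : (j : ℝ) ≠ 0 := by exact_mod_cast hj
  rw [← Real.sqrt_mul (by positivity), omegaF, omegaShift]
  congr 1
  field_simp
  ring

/-- Non-degeneracy I, item 2: the curve `κ ↦ (Ω⃗(κ), √κ)` is non-degenerate. -/
theorem nondegeneracy_I_item2
    (dpt g γ κ₁ κ₂ : ℝ) (hdpt : 0 < dpt) (hg : 0 < g) (hκ₁ : 0 < κ₁) (hκ₁₂ : κ₁ < κ₂)
    (ν : ℕ) (hν : 1 ≤ ν) (jbar : Fin ν → ℤ)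
    (hjne : ∀ a, jbar a ≠ 0)
    (hjinj : Function.Injective fun a => |jbar a|) :
    ∀ (c : Fin ν → ℝ) (d : ℝ), (c ≠ 0 ∨ d ≠ 0) →
      ∃ κ ∈ Set.Icc κ₁ κ₂,
        (∑ a, c a * OmegaF dpt g γ (jbar a) κ) + d * Real.sqrt κ ≠ 0 := by
  intro c d hcd
  by_contra! hzero
  let b : Fin (ν + 1) → ℝ := Fin.cons 0 fun a => omegaShift dpt g γ (jbar a)
  let w : Fin (ν + 1) → ℝ :=
    Fin.cons d fun a => c a * √(Gfun dpt (jbar a) * (jbar a : ℝ) ^ 2)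
  have hb_nonneg : ∀ i, 0 ≤ b i :=
    Fin.cases le_rfl fun a => (omegaShift_pos hdpt hg γ (hjne a)).le
  have hb : Function.Injective b := by
    refine Fin.cons_injective_iff.mpr ⟨?_, fun a a' h =>
      hjinj (abs_eq_abs_of_omegaShift_eq hdpt hg (hjne a) (hjne a') h)⟩
    rintro ⟨a, ha⟩
    exact (omegaShift_pos hdpt hg γ (hjne a)).ne' ha
  have hw : w = 0 := by
    refine eq_zero_of_sum_mul_sqrt_add_eq_zero hb isOpen_Ioo (Set.nonempty_Ioo.mpr hκ₁₂)
      (fun κ hκ i => add_pos_of_pos_of_nonneg (hκ₁.trans hκ.1) (hb_nonneg i))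
      (C := ∑ a, c a * (γ / 2 * Gfun dpt (jbar a) / (jbar a : ℝ))) fun κ hκ => ?_
    rw [← hzero κ (Set.Ioo_subset_Icc_self hκ), Fin.sum_univ_succ]
    simp only [b, w, Fin.cons_zero, Fin.cons_succ, add_zero, OmegaF, mul_add,
      Finset.sum_add_distrib, omegaF_eq_sqrt_mul_sqrt hdpt g γ (hjne _), mul_assoc]
    ring
  rcases hcd with hc | hd
  · refine hc (funext fun a => ?_)
    have hG := Gfun_pos hdpt (hjne a)
    have hj : (jbar a : ℝ) ≠ 0 := by exact_mod_cast hjne a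
    exact (mul_eq_zero.mp (congrFun hw a.succ)).resolve_right
      (Real.sqrt_pos.mpr (by positivity)).ne'
  · exact hd (congrFun hw 0)
end

section
/- (Non-degeneracy I, item 4.) For every j, j' ∈ ℤ \ ({0} ∪ S ∪ (−S)) with |j| ≠ |j'|, the map κ ↦ (Ω⃗(κ), Ω_j(κ), Ω_{j'}(κ)) from [κ₁, κ₂] to ℝ^{ν+2} is non-degenerate: for every (c, d, d') ∈ ℝ^ν × ℝ × ℝ with (c, d, d') ≠ 0 there exists κ ∈ [κ₁, κ₂] such that Σ_{a=1}^{ν} c_a · Ω_{j̄_a}(κ) + d·Ω_j(κ) + d'·Ω_{j'}(κ) ≠ 0. -/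
open Real Finset Set

theorem antitoneOn_tanh_div_self : AntitoneOn (fun x : ℝ => Real.tanh x / x) (Set.Ioi 0) := by
  have hd : ∀ t ∈ Set.Ioi (0 : ℝ), HasDerivAt (fun x : ℝ => Real.sinh x / (Real.cosh x * x))
      ((Real.cosh t * (Real.cosh t * t) - Real.sinh t * (Real.sinh t * t + Real.cosh t * 1)) /
        (Real.cosh t * t) ^ 2) t := fun t ht =>
    (Real.hasDerivAt_sinh t).div ((Real.hasDerivAt_cosh t).mul (hasDerivAt_id t))
      (mul_pos (Real.cosh_pos t) ht).ne'
  simp only [Real.tanh_eq_sinh_div_cosh, div_div]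
  refine antitoneOn_of_deriv_nonpos (convex_Ioi 0)
    (fun t ht => (hd t ht).continuousAt.continuousWithinAt) ?_ ?_
  · rw [interior_Ioi]
    exact fun t ht => (hd t ht).differentiableAt.differentiableWithinAt
  · rw [interior_Ioi]
    intro t ht
    rw [(hd t ht).deriv]
    refine div_nonpos_of_nonpos_of_nonneg ?_ (sq_nonneg _)
    have h1 : t ≤ Real.sinh t := Real.self_le_sinh_iff.2 (le_of_lt ht)
    have h2 : Real.sinh t ≤ Real.sinh t * Real.cosh t :=
      le_mul_of_one_le_right ((le_of_lt ht).trans h1) (Real.one_le_cosh t)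
    calc _ = t * (Real.cosh t ^ 2 - Real.sinh t ^ 2) - Real.sinh t * Real.cosh t := by ring
      _ ≤ 0 := by
        rw [Real.cosh_sq_sub_sinh_sq]
        linarith

theorem tanh_nonneg {x : ℝ} (hx : 0 ≤ x) : 0 ≤ Real.tanh x := by
  rw [Real.tanh_eq_sinh_div_cosh]
  exact div_nonneg (Real.sinh_nonneg_iff.2 hx) (Real.cosh_pos x).le

theorem sum_mul_rpow_sub_nat_eq_zero {ι : Type*} [Fintype ι] {c l : ι → ℝ} {C κ₁ κ₂ : ℝ}
    (hl : ∀ i, 0 < l i) (hκ₁ : 0 < κ₁)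
    (h : ∀ κ ∈ Set.Ioo κ₁ κ₂, ∑ i, c i * (κ + l i) ^ (1 / 2 : ℝ) + C = 0) (n : ℕ) :
    ∀ κ ∈ Set.Ioo κ₁ κ₂, ∑ i, c i * (κ + l i) ^ (1 / 2 - (n + 1 : ℕ) : ℝ) = 0 := by
  have step : ∀ (p D : ℝ), p ≠ 0 →
      (∀ κ ∈ Set.Ioo κ₁ κ₂, ∑ i, c i * (κ + l i) ^ p + D = 0) →
      ∀ κ ∈ Set.Ioo κ₁ κ₂, ∑ i, c i * (κ + l i) ^ (p - 1) = 0 := by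
    intro p D hp hz κ hκ
    have hd : HasDerivAt (fun x => ∑ i, c i * (x + l i) ^ p + D)
        (∑ i, c i * (1 * p * (κ + l i) ^ (p - 1))) κ := by
      refine HasDerivAt.add_const _ (HasDerivAt.fun_sum fun i _ => ?_)
      refine HasDerivAt.const_mul _ (HasDerivAt.rpow_const ((hasDerivAt_id κ).add_const _) (.inl ?_))
      exact (add_pos (hκ₁.trans hκ.1) (hl i)).ne'
    have h0 : HasDerivAt (fun x => ∑ i, c i * (x + l i) ^ p + D) 0 κ :=
      (hasDerivAt_const κ (0 : ℝ)).congr_of_eventuallyEq <| by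
        filter_upwards [isOpen_Ioo.mem_nhds hκ] with x hx using hz x hx
    have := hd.unique h0
    refine (mul_eq_zero.1 ?_).resolve_left hp
    rw [← this, Finset.mul_sum]
    exact Finset.sum_congr rfl fun i _ => by ring
  induction n with
  | zero => simpa using step _ _ (by norm_num) h
  | succ n ih =>
    intro κ hκ
    have hp : (1 / 2 - (n + 1 : ℕ) : ℝ) ≠ 0 := by
      push_cast
      have : (0 : ℝ) ≤ n := n.cast_nonneg
      linarith
    convert step _ 0 hp (by simpa using ih) κ hκ using 4
    push_cast
    ring

theorem eq_zero_of_sum_mul_sqrt_add_const_eq_zero {n : ℕ} {c l : Fin n → ℝ} {C κ₁ κ₂ : ℝ}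
    (hl : ∀ i, 0 < l i) (hinj : Function.Injective l) (hκ₁ : 0 < κ₁) (hκ₁₂ : κ₁ < κ₂)
    (h : ∀ κ ∈ Set.Ioo κ₁ κ₂, ∑ i, c i * √(κ + l i) + C = 0) : c = 0 := by
  obtain ⟨κ, hκ⟩ := Set.nonempty_Ioo.2 hκ₁₂
  have hpos : ∀ i, 0 < κ + l i := fun i => by linarith [hl i, hκ.1]
  have key : (fun i => c i * (κ + l i) ^ (1 / 2 - 1 : ℝ)) = 0 := by
    refine Matrix.eq_zero_of_forall_pow_sum_mul_pow_eq_zero (f := fun i => (κ + l i)⁻¹)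
      (fun i k hik => hinj (by simpa using hik)) fun m => ?_
    rw [← sum_mul_rpow_sub_nat_eq_zero hl hκ₁ (by simpa only [Real.sqrt_eq_rpow] using h) m κ hκ]
    refine Finset.sum_congr rfl fun i _ => ?_
    have : (1 / 2 - ((m : ℕ) + 1 : ℕ) : ℝ) = (1 / 2 - 1) - (m : ℕ) := by push_cast; ring
    rw [this, Real.rpow_sub (hpos i) (1 / 2 - 1), Real.rpow_natCast, inv_pow,
      mul_assoc, div_eq_mul_inv (_ ^ _)]
  ext i
  exact (mul_eq_zero.1 (congrFun key i)).resolve_right (Real.rpow_pos_of_pos (hpos i) _).ne'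

/-- The shift `l_j` such that `ω_j(κ) = √(G_j j²) √(κ + l_j)`, as a function of `x = |j|`. -/
noncomputable def freqShift (dpt g γ x : ℝ) : ℝ :=
  g / x ^ 2 + γ ^ 2 / 4 * (Real.tanh (dpt * x) / x ^ 3)

theorem freqShift_pos {dpt g x : ℝ} (γ : ℝ) (hdpt : 0 < dpt) (hg : 0 < g) (hx : 0 < x) :
    0 < freqShift dpt g γ x := by
  have := tanh_nonneg (mul_pos hdpt hx).le
  unfold freqShift
  positivity

theorem freqShift_strictAntiOn {dpt g : ℝ} (γ : ℝ) (hdpt : 0 < dpt) (hg : 0 < g) :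
    StrictAntiOn (freqShift dpt g γ) (Set.Ioi 0) := by
  intro x hx y hy hxy
  rw [Set.mem_Ioi] at hx hy
  have h1 : g / y ^ 2 < g / x ^ 2 := by gcongr
  have h2 : Real.tanh (dpt * y) / y ^ 3 ≤ Real.tanh (dpt * x) / x ^ 3 := by
    have ht := antitoneOn_tanh_div_self (mul_pos hdpt hx) (mul_pos hdpt hy)
      (mul_le_mul_of_nonneg_left hxy.le hdpt.le)
    have ht' : Real.tanh (dpt * y) * x ≤ Real.tanh (dpt * x) * y := by
      rw [div_le_div_iff₀ (mul_pos hdpt hy) (mul_pos hdpt hx)] at ht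
      exact le_of_mul_le_mul_left (by linarith) hdpt
    have h0 := tanh_nonneg (mul_pos hdpt hx).le
    rw [div_le_div_iff₀ (by positivity) (by positivity)]
    calc Real.tanh (dpt * y) * x ^ 3 = Real.tanh (dpt * y) * x * x ^ 2 := by ring
      _ ≤ Real.tanh (dpt * x) * y * y ^ 2 := by gcongr
      _ = _ := by ring
  have h3 := mul_le_mul_of_nonneg_left h2 (by positivity : 0 ≤ γ ^ 2 / 4)
  unfold freqShift
  linarith

theorem Gfun_eq_abs (dpt : ℝ) (j : ℤ) : Gfun dpt j = |(j : ℝ)| * Real.tanh (dpt * |(j : ℝ)|) := by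
  rcases abs_choice (j : ℝ) with h | h <;> simp [Gfun, h]

theorem omegaF_eq {dpt : ℝ} (g γ : ℝ) (hdpt : 0 < dpt) {j : ℤ} (hj : j ≠ 0) (κ : ℝ) :
    omegaF dpt g γ j κ =
      √(Gfun dpt j * (j : ℝ) ^ 2) * √(κ + freqShift dpt g γ |(j : ℝ)|) := by
  have hx : |(j : ℝ)| ≠ 0 := abs_ne_zero.2 (Int.cast_ne_zero.2 hj)
  rw [omegaF, ← Real.sqrt_mul (mul_nonneg (Gfun_pos hdpt hj).le (sq_nonneg _)), freqShift,
    div_pow, mul_pow 2, ← sq_abs (j : ℝ), Gfun_eq_abs]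
  congr 1
  field_simp
  ring

/-- Non-degeneracy of the frequencies along any family of sites with distinct absolute values. -/
theorem eq_zero_of_sum_mul_OmegaF_eq_zero {dpt g κ₁ κ₂ : ℝ} (γ : ℝ) (hdpt : 0 < dpt) (hg : 0 < g)
    (hκ₁ : 0 < κ₁) (hκ₁₂ : κ₁ < κ₂) {n : ℕ} {s : Fin n → ℤ} (hs : ∀ i, s i ≠ 0)
    (hinj : Function.Injective fun i => |s i|) {c : Fin n → ℝ}
    (h : ∀ κ ∈ Set.Icc κ₁ κ₂, ∑ i, c i * OmegaF dpt g γ (s i) κ = 0) : c = 0 := by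
  have hpos : ∀ i, 0 < |(s i : ℝ)| := fun i => abs_pos.2 (Int.cast_ne_zero.2 (hs i))
  have key : (fun i => c i * √(Gfun dpt (s i) * (s i : ℝ) ^ 2)) = 0 := by
    refine eq_zero_of_sum_mul_sqrt_add_const_eq_zero
      (l := fun i => freqShift dpt g γ |(s i : ℝ)|)
      (C := ∑ i, c i * (γ / 2 * Gfun dpt (s i) / (s i : ℝ)))
      (fun i => freqShift_pos γ hdpt hg (hpos i)) (fun i k hik => hinj ?_) hκ₁ hκ₁₂ fun κ hκ => ?_
    · have := (freqShift_strictAntiOn γ hdpt hg).injOn (hpos i) (hpos k) hik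
      exact_mod_cast this
    · rw [← h κ (Set.Ioo_subset_Icc_self hκ), ← Finset.sum_add_distrib]
      refine Finset.sum_congr rfl fun i _ => ?_
      rw [OmegaF, omegaF_eq g γ hdpt (hs i)]
      ring
  ext i
  refine (mul_eq_zero.1 (congrFun key i)).resolve_right (Real.sqrt_ne_zero'.2 ?_)
  have := Gfun_pos hdpt (hs i)
  have := sq_pos_of_pos (hpos i)
  rw [sq_abs] at this
  positivity

/-- Non-degeneracy I, item 4: for any j, j' not in {0} ∪ S ∪ (−S) with |j| ≠ |j'|,
the curve κ ↦ (Ω⃗(κ), Ω_j(κ), Ω_{j'}(κ)) is non-degenerate. -/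
theorem nondegeneracy_I_item4
    (dpt g γ κ₁ κ₂ : ℝ) (hdpt : 0 < dpt) (hg : 0 < g) (hκ₁ : 0 < κ₁) (hκ₁₂ : κ₁ < κ₂)
    (ν : ℕ) (hν : 1 ≤ ν) (jbar : Fin ν → ℤ)
    (hjne : ∀ a, jbar a ≠ 0)
    (hjinj : Function.Injective fun a => |jbar a|) :
    ∀ j j' : ℤ,
      j ≠ 0 → (∀ a, j ≠ jbar a) → (∀ a, j ≠ -jbar a) →
      j' ≠ 0 → (∀ a, j' ≠ jbar a) → (∀ a, j' ≠ -jbar a) →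
      |j| ≠ |j'| →
      ∀ (c : Fin ν → ℝ) (d d' : ℝ), (c ≠ 0 ∨ d ≠ 0 ∨ d' ≠ 0) →
        ∃ κ ∈ Set.Icc κ₁ κ₂,
          (∑ a, c a * OmegaF dpt g γ (jbar a) κ)
            + d * OmegaF dpt g γ j κ + d' * OmegaF dpt g γ j' κ ≠ 0 := by
  intro j j' hj hjS hjS' hj' hj'S hj'S' hjj c d d' hc
  by_contra! h
  have hne : ∀ {k : ℤ}, (∀ a, k ≠ jbar a) → (∀ a, k ≠ -jbar a) → ∀ a, |k| ≠ |jbar a| :=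
    fun h₁ h₂ a hk => (abs_eq_abs.1 hk).elim (h₁ a) (h₂ a)
  have hz := eq_zero_of_sum_mul_OmegaF_eq_zero (n := ν + 2) γ hdpt hg hκ₁ hκ₁₂
    (s := Fin.cons j (Fin.cons j' jbar)) (c := Fin.cons d (Fin.cons d' c))
    (by simp [Fin.forall_fin_succ, hj, hj', hjne])
    (by
      have : (fun i => |(Fin.cons j (Fin.cons j' jbar) : Fin (ν + 2) → ℤ) i|)
          = Fin.cons |j| (Fin.cons |j'| fun a => |jbar a|) := by
        ext i
        refine Fin.cases rfl (fun i => ?_) i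
        exact Fin.cases rfl (fun _ => rfl) i
      rw [this, Fin.cons_injective_iff, Fin.cons_injective_iff]
      refine ⟨?_, ?_, hjinj⟩
      · rintro ⟨i, hi⟩
        revert hi
        refine Fin.cases (fun hi => hjj hi.symm) (fun a hi => hne hjS hjS' a hi.symm) i
      · rintro ⟨a, ha⟩
        exact hne hj'S hj'S' a ha.symm)
    (fun κ hκ => by
      rw [← h κ hκ]
      simp only [Fin.sum_univ_succ, Fin.cons_zero, Fin.cons_succ]
      ring)
  have hd : d = 0 := congrFun hz 0
  have hd' : d' = 0 := congrFun hz 1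
  have hc0 : c = 0 := funext fun a => congrFun hz a.succ.succ
  simp [hd, hd', hc0] at hc
end
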